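/- Let P be a finite type of propositional variables and Q = P ⊕ P (where inr p represents the negative literal ¬p). Let R ⊆ PBF Q × PBF Q consist of all pairs (and (var (inl p)) (var (inr p)), ff) and (or (var (inl p)) (var (inr p)), tt) for p ∈ P, and let ≡_R be the semantic congruence closure of R on PBF Q. Then for every positive Boolean formula ψ : PBF Q, it is NOT the case that ψ ≡_R ff if and only if there exists an assignment m : P → Bool such that eval m̂ ψ = true, where m̂ (inl p) = m p and m̂ (inr p) = ! (m p). (In particular, a CNF formula φ over P is satisfiable if and only if its positive encoding φ̂—obtained by replacing each negative literal ¬p by var (inr p)—is not ≡_R-equivalent to ff.) -/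

import Mathlib

/-- Positive Boolean formulas over a type `Q`. -/
inductive PBF (Q : Type u) : Type u where
  | tt : PBF Q
  | ff : PBF Q
  | var : Q → PBF Q
  | and : PBF Q → PBF Q → PBF Q
  | or : PBF Q → PBF Q → PBF Q

/-- Evaluation of a positive Boolean formula under a model `m : Q → Bool`. -/
def PBF.eval {Q : Type*} (m : Q → Bool) : PBF Q → Bool
  | .tt => true
  | .ff => false
  | .var q => m q
  | .and p q => p.eval m && q.eval m
  | .or p q => p.eval m || q.eval m

/-- The semantic congruence closure of a relation `R` on positive Boolean formulas: the
smallest relation containing `R` and all pairs of logically equivalent formulas, that is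
symmetric, transitive, and compatible with `and` and `or`. -/
inductive SemCong {Q : Type*} (R : PBF Q → PBF Q → Prop) : PBF Q → PBF Q → Prop
  | of {p q : PBF Q} : R p q → SemCong R p q
  | equiv {p q : PBF Q} : (∀ m : Q → Bool, p.eval m = q.eval m) → SemCong R p q
  | symm {p q : PBF Q} : SemCong R p q → SemCong R q p
  | trans {p q r : PBF Q} : SemCong R p q → SemCong R q r → SemCong R p r
  | and {p₁ q₁ p₂ q₂ : PBF Q} : SemCong R p₁ q₁ → SemCong R p₂ q₂ →
      SemCong R (.and p₁ p₂) (.and q₁ q₂)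
  | or {p₁ q₁ p₂ q₂ : PBF Q} : SemCong R p₁ q₁ → SemCong R p₂ q₂ →
      SemCong R (.or p₁ p₂) (.or q₁ q₂)

/-- The relation axiomatizing negation: `p ∧ p̄ ≡ ff` and `p ∨ p̄ ≡ tt` for each
propositional variable `p` (where `inr p` represents the negative literal `¬p`). -/
def NegAxioms (P : Type*) : PBF (P ⊕ P) → PBF (P ⊕ P) → Prop := fun x y =>
  ∃ p : P,
    (x = .and (.var (.inl p)) (.var (.inr p)) ∧ y = .ff) ∨
    (x = .or (.var (.inl p)) (.var (.inr p)) ∧ y = .tt)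

namespace PBF

variable {Q ι : Type*}

/-- The disjunction of the formulas `f i` for `i` in a list. -/
def disj (f : ι → PBF Q) (l : List ι) : PBF Q := l.foldr (fun i p => .or (f i) p) .ff

/-- The conjunction of the formulas `f i` for `i` in a list. -/
def conj (f : ι → PBF Q) (l : List ι) : PBF Q := l.foldr (fun i p => .and (f i) p) .tt

theorem eval_disj (m : Q → Bool) (f : ι → PBF Q) (l : List ι) :
    (disj f l).eval m = true ↔ ∃ i ∈ l, (f i).eval m = true := by
  induction l with
  | nil => simp [disj, eval]
  | cons i l ih => simpa [disj, eval] using or_congr_right ih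

theorem eval_conj (m : Q → Bool) (f : ι → PBF Q) (l : List ι) :
    (conj f l).eval m = true ↔ ∀ i ∈ l, (f i).eval m = true := by
  induction l with
  | nil => simp [conj, eval]
  | cons i l ih => simpa [conj, eval] using and_congr_right fun _ => ih

end PBF

namespace SemCong

variable {Q ι : Type*} {R : PBF Q → PBF Q → Prop}

theorem refl (p : PBF Q) : SemCong R p p := .equiv fun _ => rfl

/-- A model that respects `R` respects its semantic congruence closure. -/
theorem eval_eq {p q : PBF Q} (h : SemCong R p q) {m : Q → Bool}
    (hm : ∀ x y, R x y → x.eval m = y.eval m) : p.eval m = q.eval m := by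
  induction h with
  | of h => exact hm _ _ h
  | equiv h => exact h m
  | symm _ ih => exact ih.symm
  | trans _ _ ih₁ ih₂ => exact ih₁.trans ih₂
  | and _ _ ih₁ ih₂ => simp only [PBF.eval, ih₁, ih₂]
  | or _ _ ih₁ ih₂ => simp only [PBF.eval, ih₁, ih₂]

theorem disj_ff {f : ι → PBF Q} (h : ∀ i, SemCong R (f i) .ff) (l : List ι) :
    SemCong R (PBF.disj f l) .ff := by
  induction l with
  | nil => exact refl _
  | cons i l ih => exact ((h i).or ih).trans (.equiv fun _ => rfl)

theorem conj_tt {f : ι → PBF Q} (h : ∀ i, SemCong R (f i) .tt) (l : List ι) :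
    SemCong R (PBF.conj f l) .tt := by
  induction l with
  | nil => exact refl _
  | cons i l ih => exact ((h i).and ih).trans (.equiv fun _ => rfl)

/-- If `p` and `c` together entail `d`, where `c` is congruent to `tt` and `d` to `ff`, then `p` is
congruent to `ff`. -/
theorem ff_of_entails {p c d : PBF Q} (hc : SemCong R c .tt) (hd : SemCong R d .ff)
    (h : ∀ m : Q → Bool, p.eval m = true → c.eval m = true → d.eval m = true) :
    SemCong R p .ff := by
  have h₁ : SemCong R p (.or (.and p .tt) .ff) := .equiv fun m => by simp [PBF.eval]
  have h₂ : SemCong R (.or (.and p .tt) .ff) (.or (.and p c) d) :=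
    ((refl p).and hc.symm).or hd.symm
  have h₃ : SemCong R (.or (.and p c) d) d := .equiv fun m => by
    have := h m
    simp only [PBF.eval]
    grind
  exact ((h₁.trans h₂).trans h₃).trans hd

end SemCong

/-- An assignment that negates `inr p` validates the negation axioms. -/
theorem NegAxioms.eval_eq {P : Type*} {x y : PBF (P ⊕ P)} (h : NegAxioms P x y) (m : P → Bool) :
    x.eval (Sum.elim m fun p => ! m p) = y.eval (Sum.elim m fun p => ! m p) := by
  obtain ⟨p, ⟨rfl, rfl⟩ | ⟨rfl, rfl⟩⟩ := h <;> simp [PBF.eval]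

/-- A formula with no satisfying consistent assignment is congruent to `ff` modulo the negation
axioms. -/
theorem SemCong.ff_of_unsatisfiable {P : Type*} [Fintype P] (ψ : PBF (P ⊕ P))
    (h : ∀ m : P → Bool, ¬ ψ.eval (Sum.elim m fun p => ! m p) = true) :
    SemCong (NegAxioms P) ψ .ff := by
  refine ff_of_entails
    (conj_tt (f := fun p => .or (.var (.inl p)) (.var (.inr p)))
      (fun p => .of ⟨p, .inr ⟨rfl, rfl⟩⟩) Finset.univ.toList)
    (disj_ff (f := fun p => .and (.var (.inl p)) (.var (.inr p)))
      (fun p => .of ⟨p, .inl ⟨rfl, rfl⟩⟩) Finset.univ.toList) fun m hψ hc => ?_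
  rw [PBF.eval_conj] at hc
  rw [PBF.eval_disj]
  by_contra hd
  have hm : m = Sum.elim (fun p => m (.inl p)) fun p => ! m (.inl p) := by
    funext q
    cases q with
    | inl p => rfl
    | inr p =>
      have hp : p ∈ Finset.univ.toList := by simp
      have hcp := hc p hp
      have hdp := fun hp' => hd ⟨p, hp, hp'⟩
      simp only [PBF.eval] at hcp hdp
      simp only [Sum.elim_inr]
      grind
  exact h (fun p => m (.inl p)) (hm ▸ hψ)

/-- Correctness of the NP-hardness reduction from SAT to CONGRUENCE: a positive Boolean
formula over `P ⊕ P` is not congruent to `ff` modulo the negation axioms iff it is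
satisfiable by some assignment that interprets `inr p` as the negation of `inl p`. -/
theorem stmt_12 (P : Type*) [Fintype P] (ψ : PBF (P ⊕ P)) :
    ¬ SemCong (NegAxioms P) ψ .ff ↔
      ∃ m : P → Bool, ψ.eval (Sum.elim m (fun p => ! m p)) = true := by
  rw [← not_forall_not, not_iff_not]
  constructor
  · intro h m
    simp [h.eval_eq (fun _ _ hR => hR.eval_eq m), PBF.eval]
  · exact SemCong.ff_of_unsatisfiable ψ
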